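/- Let a > 1/2 and ε ∈ (0,1) be fixed with ε sufficiently small. Define w_N(t,x) := √(2π/log N) · (2π)^{−2} ∫_{1<|ξ|<e^{−a}N} |ξ|^{−2} e^{i(−t|ξ|² + ξ·x)} dξ. Then there exist constants c₁, c₂ > 0 (depending only on a and ε) and N₀ such that for all integers N ≥ N₀ and all (t,x) with ε²/(4N²) ≤ t ≤ ε²/(2N²) and ε/(4N) ≤ |x| ≤ ε/(2N): c₁ ε N / √(log N) ≤ |∇w_N(t,x)| ≤ c₂ ε N / √(log N), and moreover Re w_N(t,x) ≥ √(log N/(2π)) − c₂/√(log N). -/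

import Mathlib

open MeasureTheory Real Classical
open scoped ENNReal RealInnerProductSpace

noncomputable section

/-- The plane `ℝ²`. -/
abbrev Plane := EuclideanSpace ℝ (Fin 2)

/-- Pointwise norm of the (full) gradient of `u`. -/
def gradNorm (u : Plane → ℝ) (x : Plane) : ℝ := ‖fderiv ℝ u x‖

/-- The `L^p` norm for a real (finite) exponent `p`. -/
def LpNorm (p : ℝ) (u : Plane → ℝ) : ℝ := (∫ x : Plane, |u x| ^ p) ^ (1 / p)

/-- The sup (`L^∞`) norm. -/
def supNorm (u : Plane → ℝ) : ℝ := ⨆ x : Plane, |u x|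

/-- The homogeneous Hölder seminorm `[u]_α`. -/
def holderSemi (α : ℝ) (u : Plane → ℝ) : ℝ :=
  ⨆ p : Plane × Plane,
    if p.1 = p.2 then 0 else |u p.1 - u p.2| / ‖p.1 - p.2‖ ^ α

/-- The Hölder norm `‖u‖_{C^α} = sup |u| + [u]_α`. -/
def holderNorm (α : ℝ) (u : Plane → ℝ) : ℝ := supNorm u + holderSemi α u

/-- `u` is `α`-Hölder continuous. -/
def IsHolder (α : ℝ) (u : Plane → ℝ) : Prop :=
  ∃ C : ℝ, 0 ≤ C ∧ ∀ x y : Plane, |u x - u y| ≤ C * ‖x - y‖ ^ α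

/-- The squared `H¹` norm `‖∇u‖_{L²}² + ‖u‖_{L²}²`. -/
def H1Sq (u : Plane → ℝ) : ℝ :=
  (∫ x : Plane, gradNorm u x ^ 2) + ∫ x : Plane, u x ^ 2

/-- The squared local `H¹` norm `‖u‖_{H¹[R]}²`. -/
def H1locSq (R : ℝ) (u : Plane → ℝ) : ℝ :=
  ⨆ c : Plane, ∫ x in Metric.closedBall c R, (gradNorm u x ^ 2 + u x ^ 2)

/-- Membership in `H¹(ℝ²)` (with classical derivatives). -/
def MemH1 (u : Plane → ℝ) : Prop :=
  Differentiable ℝ u ∧ Integrable (fun x => u x ^ 2) ∧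
    Integrable (fun x => gradNorm u x ^ 2)

/-- The nonlinearity `f(u) = (e^{4π u²} - 1 - 4π u²) u`. -/
def f (s : ℝ) : ℝ := (Real.exp (4 * π * s ^ 2) - 1 - 4 * π * s ^ 2) * s

/-- The potential `F(u) = (1/8π)(e^{4π u²} - 1 - 4π u² - 8π² u⁴)`. -/
def F (s : ℝ) : ℝ :=
  (8 * π)⁻¹ * (Real.exp (4 * π * s ^ 2) - 1 - 4 * π * s ^ 2 - 8 * π ^ 2 * s ^ 4)

/-- Pointwise norm of the gradient of a complex-valued function. -/
def gradNormC (u : Plane → ℂ) (x : Plane) : ℝ := ‖fderiv ℝ u x‖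

/-- The nonlinearity `f(u) = (e^{4π|u|²} - 1 - 4π|u|²) u` for complex `u`. -/
def fC (z : ℂ) : ℂ :=
  ((Real.exp (4 * π * ‖z‖ ^ 2) - 1 - 4 * π * ‖z‖ ^ 2 : ℝ) : ℂ) * z

/-- The potential `F(u)` for complex `u`. -/
def FC (z : ℂ) : ℝ :=
  (8 * π)⁻¹ *
    (Real.exp (4 * π * ‖z‖ ^ 2) - 1 - 4 * π * ‖z‖ ^ 2 - 8 * π ^ 2 * ‖z‖ ^ 4)

/-- `u` is `α`-Hölder continuous (complex-valued version). -/
def IsHolderC (α : ℝ) (u : Plane → ℂ) : Prop :=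
  ∃ C : ℝ, 0 ≤ C ∧ ∀ x y : Plane, ‖u x - u y‖ ≤ C * ‖x - y‖ ^ α

/-- The Hölder norm `‖u‖_{C^α}` (complex-valued version). -/
def holderNormC (α : ℝ) (u : Plane → ℂ) : ℝ :=
  (⨆ x : Plane, ‖u x‖) +
    ⨆ p : Plane × Plane,
      if p.1 = p.2 then 0 else ‖u p.1 - u p.2‖ / ‖p.1 - p.2‖ ^ α

/-- The frequency annulus `1 < |ξ| < e^{-a} N`. -/
def freqSet (a N : ℝ) : Set Plane := {ξ | 1 < ‖ξ‖ ∧ ‖ξ‖ < Real.exp (-a) * N}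

/-- The concentrating family of radial free Schrödinger solutions `w_N`. -/
def wS (a : ℝ) (N : ℕ) (t : ℝ) (x : Plane) : ℂ :=
  (Real.sqrt (2 * π / Real.log N) * (2 * π) ^ (-2 : ℤ) : ℝ) •
    ∫ ξ in freqSet a N,
      (‖ξ‖ ^ (-2 : ℤ) : ℝ) •
        Complex.exp (Complex.I * Complex.ofReal (-t * ‖ξ‖ ^ 2 + ⟪ξ, x⟫))

lemma measurableSet_freqSet (a N : ℝ) : MeasurableSet (freqSet a N) :=
  (measurableSet_lt measurable_const measurable_norm).inter
    (measurableSet_lt measurable_norm measurable_const)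

lemma freqSet_subset_ball (a N : ℝ) : freqSet a N ⊆ Metric.ball 0 (Real.exp (-a) * N) :=
  fun ξ hξ => by simpa using hξ.2

lemma volume_freqSet_lt_top (a N : ℝ) : volume (freqSet a N) < ⊤ :=
  (measure_mono (freqSet_subset_ball a N)).trans_lt measure_ball_lt_top

/-- Integration of a radial function over the annulus in polar coordinates. -/
lemma setIntegral_freqSet_norm {a N : ℝ} (hR : 1 ≤ Real.exp (-a) * N) (g : ℝ → ℝ) :
    ∫ ξ in freqSet a N, g ‖ξ‖ = 2 * π * ∫ r in (1 : ℝ)..(Real.exp (-a) * N), r * g r := by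
  have h1 : ∀ ξ : Plane, (freqSet a N).indicator (fun ξ => g ‖ξ‖) ξ =
      (Set.Ioo 1 (Real.exp (-a) * N)).indicator g ‖ξ‖ := fun ξ => rfl
  rw [← integral_indicator (measurableSet_freqSet a N)]
  simp_rw [h1]
  rw [integral_fun_norm_addHaar volume]
  have hvol : (volume : Measure Plane).real (Metric.ball 0 1) = π := by
    simp [measureReal_def, EuclideanSpace.volume_ball_fin_two, Real.pi_pos.le]
  have hind : ∀ y : ℝ, y ^ (Module.finrank ℝ Plane - 1) •
      (Set.Ioo 1 (Real.exp (-a) * N)).indicator g y =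
      (Set.Ioo 1 (Real.exp (-a) * N)).indicator (fun r => r * g r) y := by
    intro y
    by_cases hy : y ∈ Set.Ioo 1 (Real.exp (-a) * N) <;> simp [hy]
  simp_rw [hind]
  rw [hvol, setIntegral_indicator measurableSet_Ioo,
    Set.inter_eq_right.2 (fun y (hy : y ∈ Set.Ioo _ _) => Set.mem_Ioi.2 (one_pos.trans hy.1)),
    intervalIntegral.integral_of_le hR, integral_Ioc_eq_integral_Ioo]
  simp [mul_assoc]

lemma volume_real_freqSet {a N : ℝ} (hR : 1 ≤ Real.exp (-a) * N) :
    volume.real (freqSet a N) = π * ((Real.exp (-a) * N) ^ 2 - 1) := by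
  have h := setIntegral_freqSet_norm hR (fun _ => 1)
  simp only [setIntegral_const, smul_eq_mul, mul_one, integral_id] at h
  rw [h]; ring

lemma setIntegral_freqSet_norm_zpow {a N : ℝ} (hR : 1 ≤ Real.exp (-a) * N) :
    ∫ ξ in freqSet a N, ‖ξ‖ ^ (-2 : ℤ) = 2 * π * Real.log (Real.exp (-a) * N) := by
  rw [setIntegral_freqSet_norm hR (fun r => r ^ (-2 : ℤ))]
  have : ∀ r : ℝ, r * r ^ (-2 : ℤ) = r⁻¹ := by
    intro r
    rcases eq_or_ne r 0 with rfl | hr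
    · simp
    · rw [zpow_neg]; norm_cast; field_simp
  simp_rw [this]
  rw [integral_inv_of_pos one_pos (one_pos.trans_le hR), div_one]

/-- The annulus is invariant under linear isometries. -/
lemma setIntegral_freqSet_comp {E : Type*} [NormedAddCommGroup E] [NormedSpace ℝ E] (a N : ℝ)
    (J : Plane ≃ₗᵢ[ℝ] Plane) (g : Plane → E) :
    ∫ ξ in freqSet a N, g (J ξ) = ∫ ξ in freqSet a N, g ξ := by
  have h := J.measurePreserving.setIntegral_preimage_emb
    J.toHomeomorph.measurableEmbedding g (freqSet a N)
  rw [← h]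
  congr 2
  ext ξ
  simp [freqSet]

lemma norm_zpow_le_one {a N : ℝ} {ξ : Plane} (hξ : ξ ∈ freqSet a N) :
    ‖ξ‖ ^ (-2 : ℤ) ≤ 1 :=
  zpow_le_one_of_nonpos₀ hξ.1.le (by norm_num)

lemma norm_zpow_mul_sq {a N : ℝ} {ξ : Plane} (hξ : ξ ∈ freqSet a N) :
    ‖ξ‖ ^ (-2 : ℤ) * ‖ξ‖ ^ 2 = 1 := by
  have : ‖ξ‖ ≠ 0 := (one_pos.trans hξ.1).ne'
  rw [zpow_neg]; norm_cast; field_simp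

lemma measurable_norm_zpow : Measurable fun ξ : Plane => ‖ξ‖ ^ (-2 : ℤ) := by
  simp_rw [zpow_neg]
  norm_cast
  fun_prop

/-- A bounded function on the annulus is integrable. -/
lemma integrableOn_freqSet {E : Type*} [NormedAddCommGroup E] {a N : ℝ} {g : Plane → E} (C : ℝ)
    (hg : AEStronglyMeasurable g (volume.restrict (freqSet a N)))
    (h : ∀ ξ ∈ freqSet a N, ‖g ξ‖ ≤ C) : IntegrableOn g (freqSet a N) :=
  IntegrableOn.of_bound (volume_freqSet_lt_top a N) hg C
    ((ae_restrict_iff' (measurableSet_freqSet a N)).2 (.of_forall h))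

/-- Averaging over a quarter turn: the mean of `⟪ξ, x⟫² / |ξ|²` is `|x|² / 2`. -/
lemma setIntegral_freqSet_inner_sq (a N : ℝ) (x : Plane) :
    ∫ ξ in freqSet a N, ‖ξ‖ ^ (-2 : ℤ) * ⟪ξ, x⟫ ^ 2 =
      ‖x‖ ^ 2 * volume.real (freqSet a N) / 2 := by
  have : Fact (Module.finrank ℝ Plane = 2) := ⟨by simp⟩
  let o : Orientation ℝ Plane (Fin 2) :=
    (EuclideanSpace.basisFun (Fin 2) ℝ).toBasis.orientation
  have hint : ∀ y : Plane, IntegrableOn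
      (fun ξ : Plane => ‖ξ‖ ^ (-2 : ℤ) * ⟪ξ, y⟫ ^ 2) (freqSet a N) := by
    intro y
    refine integrableOn_freqSet (‖y‖ ^ 2)
      (measurable_norm_zpow.mul (by fun_prop)).aestronglyMeasurable fun ξ hξ => ?_
    have h1 : ⟪ξ, y⟫ ^ 2 ≤ ‖ξ‖ ^ 2 * ‖y‖ ^ 2 := by
      rw [← mul_pow, sq_le_sq, abs_of_nonneg (by positivity : 0 ≤ ‖ξ‖ * ‖y‖)]
      exact abs_real_inner_le_norm ξ y
    rw [Real.norm_of_nonneg (by positivity)]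
    calc ‖ξ‖ ^ (-2 : ℤ) * ⟪ξ, y⟫ ^ 2 ≤ ‖ξ‖ ^ (-2 : ℤ) * (‖ξ‖ ^ 2 * ‖y‖ ^ 2) := by gcongr
      _ = ‖y‖ ^ 2 := by rw [← mul_assoc, norm_zpow_mul_sq hξ, one_mul]
  have hrot := setIntegral_freqSet_comp a N o.rightAngleRotation
    (fun ξ => ‖ξ‖ ^ (-2 : ℤ) * ⟪ξ, x⟫ ^ 2)
  have hrot_int : IntegrableOn (fun ξ : Plane => ‖o.rightAngleRotation ξ‖ ^ (-2 : ℤ) *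
      ⟪o.rightAngleRotation ξ, x⟫ ^ 2) (freqSet a N) := by
    refine (hint (-o.rightAngleRotation x)).congr_fun (fun ξ _ => ?_)
      (measurableSet_freqSet a N)
    simp
  have hsum := integral_add (hint x) hrot_int
  rw [hrot] at hsum
  have hconst : ∫ ξ in freqSet a N, (‖ξ‖ ^ (-2 : ℤ) * ⟪ξ, x⟫ ^ 2 +
      ‖o.rightAngleRotation ξ‖ ^ (-2 : ℤ) * ⟪o.rightAngleRotation ξ, x⟫ ^ 2) =
      ∫ _ξ in freqSet a N, ‖x‖ ^ 2 := by
    refine setIntegral_congr_fun (measurableSet_freqSet a N) fun ξ hξ => ?_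
    simp only [LinearIsometryEquiv.norm_map, o.inner_rightAngleRotation_left]
    rw [← mul_add, o.inner_sq_add_areaForm_sq, ← mul_assoc, norm_zpow_mul_sq hξ, one_mul]
  rw [hconst, setIntegral_const, smul_eq_mul] at hsum
  linarith

/-- By symmetry under `ξ ↦ -ξ` the spatial phase may be replaced by a cosine. -/
lemma wS_eq_integral_cos (a : ℝ) (N : ℕ) (t : ℝ) (x : Plane) :
    wS a N t x = (Real.sqrt (2 * π / Real.log N) * (2 * π) ^ (-2 : ℤ) : ℝ) •
      ∫ ξ in freqSet a N, Real.cos ⟪ξ, x⟫ •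
        ((‖ξ‖ ^ (-2 : ℤ) : ℝ) • Complex.exp (Complex.I * Complex.ofReal (-t * ‖ξ‖ ^ 2))) := by
  have hint : ∀ y : Plane, IntegrableOn (fun ξ : Plane => (‖ξ‖ ^ (-2 : ℤ) : ℝ) •
        Complex.exp (Complex.I * Complex.ofReal (-t * ‖ξ‖ ^ 2 + ⟪ξ, y⟫))) (freqSet a N) := by
    intro y
    refine integrableOn_freqSet 1
      (measurable_norm_zpow.aestronglyMeasurable.smul
        (Continuous.aestronglyMeasurable (by fun_prop))) fun ξ hξ => ?_
    rw [norm_smul, Complex.norm_exp_I_mul_ofReal, mul_one, Real.norm_of_nonneg (by positivity)]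
    exact norm_zpow_le_one hξ
  have hneg := setIntegral_freqSet_comp a N (LinearIsometryEquiv.neg ℝ)
    (fun ξ => (‖ξ‖ ^ (-2 : ℤ) : ℝ) •
        Complex.exp (Complex.I * Complex.ofReal (-t * ‖ξ‖ ^ 2 + ⟪ξ, x⟫)))
  have hneg_int : IntegrableOn (fun ξ : Plane => (‖-ξ‖ ^ (-2 : ℤ) : ℝ) •
        Complex.exp (Complex.I * Complex.ofReal (-t * ‖-ξ‖ ^ 2 + ⟪-ξ, x⟫))) (freqSet a N) := by
    simpa using hint (-x)
  simp only [LinearIsometryEquiv.coe_neg] at hneg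
  have hsum := integral_add (hint x) hneg_int
  rw [hneg] at hsum
  have hcos : ∀ ξ : Plane, (‖ξ‖ ^ (-2 : ℤ) : ℝ) •
        Complex.exp (Complex.I * Complex.ofReal (-t * ‖ξ‖ ^ 2 + ⟪ξ, x⟫)) +
      (‖-ξ‖ ^ (-2 : ℤ) : ℝ) •
        Complex.exp (Complex.I * Complex.ofReal (-t * ‖-ξ‖ ^ 2 + ⟪-ξ, x⟫)) =
      (2 : ℂ) * (Real.cos ⟪ξ, x⟫ • ((‖ξ‖ ^ (-2 : ℤ) : ℝ) •
        Complex.exp (Complex.I * Complex.ofReal (-t * ‖ξ‖ ^ 2)))) := by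
    intro ξ
    simp only [norm_neg, inner_neg_left, Complex.real_smul, Complex.ofReal_cos, Complex.ofReal_add,
      Complex.ofReal_neg, mul_add, Complex.exp_add]
    have hc : (2 : ℂ) * Complex.cos ((⟪ξ, x⟫ : ℝ) : ℂ) =
        Complex.exp (Complex.I * (⟪ξ, x⟫ : ℝ)) + Complex.exp (Complex.I * -(⟪ξ, x⟫ : ℝ)) := by
      rw [Complex.two_cos]; ring_nf
    linear_combination (-((‖ξ‖ ^ (-2 : ℤ) : ℝ) : ℂ) *
      Complex.exp (Complex.I * Complex.ofReal (-t * ‖ξ‖ ^ 2))) * hc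
  simp_rw [hcos] at hsum
  rw [integral_const_mul, ← two_mul] at hsum
  rw [wS, mul_left_cancel₀ two_ne_zero hsum]

/-- The derivative in `y` of the integrand in `wS_eq_integral_cos`. -/
def cosIntegrandDeriv (t : ℝ) (y ξ : Plane) : Plane →L[ℝ] ℂ :=
  (innerSL ℝ ξ).smulRight (-Real.sin ⟪ξ, y⟫ •
    ((‖ξ‖ ^ (-2 : ℤ) : ℝ) • Complex.exp (Complex.I * Complex.ofReal (-t * ‖ξ‖ ^ 2))))

lemma norm_cosIntegrandDeriv (t : ℝ) (y ξ : Plane) :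
    ‖cosIntegrandDeriv t y ξ‖ = ‖ξ‖ * (|Real.sin ⟪ξ, y⟫| * ‖ξ‖ ^ (-2 : ℤ)) := by
  rw [cosIntegrandDeriv, ContinuousLinearMap.norm_smulRight_apply, innerSL_apply_norm, norm_smul,
    norm_smul, Complex.norm_exp_I_mul_ofReal, mul_one, norm_neg, Real.norm_eq_abs,
    Real.norm_of_nonneg (by positivity)]

lemma norm_cosIntegrandDeriv_le {a N : ℝ} (t : ℝ) (y : Plane) {ξ : Plane}
    (hξ : ξ ∈ freqSet a N) : ‖cosIntegrandDeriv t y ξ‖ ≤ ‖y‖ := by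
  rw [norm_cosIntegrandDeriv]
  calc ‖ξ‖ * (|Real.sin ⟪ξ, y⟫| * ‖ξ‖ ^ (-2 : ℤ))
      ≤ ‖ξ‖ * ((‖ξ‖ * ‖y‖) * ‖ξ‖ ^ (-2 : ℤ)) := by
        gcongr
        exact Real.abs_sin_le_abs.trans (abs_real_inner_le_norm ξ y)
    _ = (‖ξ‖ ^ (-2 : ℤ) * ‖ξ‖ ^ 2) * ‖y‖ := by ring
    _ = ‖y‖ := by rw [norm_zpow_mul_sq hξ, one_mul]

lemma aestronglyMeasurable_cosIntegrandDeriv (a N t : ℝ) (y : Plane) :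
    AEStronglyMeasurable (cosIntegrandDeriv t y) (volume.restrict (freqSet a N)) := by
  have h : cosIntegrandDeriv t y = fun ξ => (‖ξ‖ ^ (-2 : ℤ) : ℝ) •
      (innerSL ℝ ξ).smulRight (-Real.sin ⟪ξ, y⟫ •
        Complex.exp (Complex.I * Complex.ofReal (-t * ‖ξ‖ ^ 2))) := by
    ext ξ v
    simp only [cosIntegrandDeriv, ContinuousLinearMap.smulRight_apply,
      smul_apply, Complex.real_smul]
    ring
  rw [h]
  refine measurable_norm_zpow.aestronglyMeasurable.smul
    (Continuous.aestronglyMeasurable ?_)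
  fun_prop

lemma integrableOn_cosIntegrandDeriv (a N t : ℝ) (y : Plane) :
    IntegrableOn (cosIntegrandDeriv t y) (freqSet a N) :=
  integrableOn_freqSet ‖y‖ (aestronglyMeasurable_cosIntegrandDeriv a N t y)
    fun _ hξ => norm_cosIntegrandDeriv_le t y hξ

lemma aestronglyMeasurable_cosIntegrand (a N t : ℝ) (y : Plane) :
    AEStronglyMeasurable (fun ξ : Plane => Real.cos ⟪ξ, y⟫ • ((‖ξ‖ ^ (-2 : ℤ) : ℝ) •
      Complex.exp (Complex.I * Complex.ofReal (-t * ‖ξ‖ ^ 2))))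
      (volume.restrict (freqSet a N)) := by
  have hcos : Continuous fun ξ : Plane => Real.cos ⟪ξ, y⟫ := by fun_prop
  have hexp : Continuous fun ξ : Plane =>
      Complex.exp (Complex.I * Complex.ofReal (-t * ‖ξ‖ ^ 2)) := by fun_prop
  exact hcos.aestronglyMeasurable.smul
    (measurable_norm_zpow.aestronglyMeasurable.smul hexp.aestronglyMeasurable)

lemma integrableOn_cosIntegrand (a N t : ℝ) (y : Plane) :
    IntegrableOn (fun ξ : Plane => Real.cos ⟪ξ, y⟫ • ((‖ξ‖ ^ (-2 : ℤ) : ℝ) •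
      Complex.exp (Complex.I * Complex.ofReal (-t * ‖ξ‖ ^ 2)))) (freqSet a N) := by
  refine integrableOn_freqSet 1 (aestronglyMeasurable_cosIntegrand a N t y) fun ξ hξ => ?_
  rw [norm_smul, norm_smul, Complex.norm_exp_I_mul_ofReal, mul_one,
    Real.norm_of_nonneg (by positivity : 0 ≤ ‖ξ‖ ^ (-2 : ℤ)), Real.norm_eq_abs]
  exact mul_le_one₀ (Real.abs_cos_le_one _) (by positivity) (norm_zpow_le_one hξ)

lemma fderiv_wS (a : ℝ) (N : ℕ) (t : ℝ) (x : Plane) :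
    fderiv ℝ (fun y => wS a N t y) x =
      (Real.sqrt (2 * π / Real.log N) * (2 * π) ^ (-2 : ℤ) : ℝ) •
        ∫ ξ in freqSet a N, cosIntegrandDeriv t x ξ := by
  simp_rw [wS_eq_integral_cos]
  refine HasFDerivAt.fderiv (.fun_const_smul ?_ _)
  refine hasFDerivAt_integral_of_dominated_of_fderiv_le (bound := fun _ => ‖x‖ + 1)
    (Metric.ball_mem_nhds x one_pos) (.of_forall fun y => aestronglyMeasurable_cosIntegrand a N t y)
    (integrableOn_cosIntegrand a N t x) (aestronglyMeasurable_cosIntegrandDeriv a N t x) ?_ ?_ ?_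
  · rw [ae_restrict_iff' (measurableSet_freqSet a N)]
    refine .of_forall fun ξ hξ y hy => (norm_cosIntegrandDeriv_le t y hξ).trans ?_
    rw [mem_ball_iff_norm] at hy
    linarith [norm_le_norm_add_norm_sub' y x]
  · exact integrableOn_const (volume_freqSet_lt_top a N).ne
  · refine .of_forall fun ξ y _ => ?_
    have h1 : HasFDerivAt (fun y : Plane => Real.cos ⟪ξ, y⟫)
        (-Real.sin ⟪ξ, y⟫ • innerSL ℝ ξ) y := (innerSL ℝ ξ).hasFDerivAt.cos
    convert h1.smul_const ((‖ξ‖ ^ (-2 : ℤ) : ℝ) •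
      Complex.exp (Complex.I * Complex.ofReal (-t * ‖ξ‖ ^ 2))) using 1
    ext v
    simp only [cosIntegrandDeriv, ContinuousLinearMap.smulRight_apply,
      smul_apply, Complex.real_smul, smul_eq_mul, Complex.ofReal_mul]
    ring

lemma norm_integral_cosIntegrandDeriv_le (a N t : ℝ) (x : Plane) :
    ‖∫ ξ in freqSet a N, cosIntegrandDeriv t x ξ‖ ≤ ‖x‖ * volume.real (freqSet a N) :=
  norm_setIntegral_le_of_norm_le_const (volume_freqSet_lt_top a N)
    fun _ hξ => norm_cosIntegrandDeriv_le t x hξ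

lemma half_sq_le_mul_sin {s : ℝ} (hs : |s| ≤ 1) : s ^ 2 / 2 ≤ s * Real.sin s := by
  have key : ∀ u : ℝ, 0 ≤ u → u ≤ 1 → u ^ 2 / 2 ≤ u * Real.sin u := by
    intro u h0 h1
    have h2 := Real.mul_le_sin h0 (by linarith [Real.pi_gt_three])
    have h3 : 1 / 2 ≤ 2 / π := by
      rw [div_le_div_iff₀ two_pos Real.pi_pos]; linarith [Real.pi_lt_four]
    nlinarith [mul_le_mul_of_nonneg_right h3 h0]
  rcases le_total 0 s with h | h
  · exact key s h (by rwa [abs_of_nonneg h] at hs)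
  · simpa using key (-s) (by linarith) (by rwa [abs_of_nonpos h] at hs)

lemma le_norm_integral_cosIntegrandDeriv {a N t : ℝ} {x : Plane} (hx : x ≠ 0)
    (ht : ∀ ξ ∈ freqSet a N, |t * ‖ξ‖ ^ 2| ≤ 1) (hs : ∀ ξ ∈ freqSet a N, ‖ξ‖ * ‖x‖ ≤ 1) :
    ‖x‖ * volume.real (freqSet a N) / 8 ≤ ‖∫ ξ in freqSet a N, cosIntegrandDeriv t x ξ‖ := by
  set T := ∫ ξ in freqSet a N, cosIntegrandDeriv t x ξ with hT
  have hTx : -(T x).re = ∫ ξ in freqSet a N,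
      ‖ξ‖ ^ (-2 : ℤ) * (⟪ξ, x⟫ * Real.sin ⟪ξ, x⟫) * Real.cos (t * ‖ξ‖ ^ 2) := by
    have hi := (integrableOn_cosIntegrandDeriv a N t x).apply_continuousLinearMap x
    rw [hT, ContinuousLinearMap.integral_apply (integrableOn_cosIntegrandDeriv a N t x),
      ← Complex.reCLM_apply, ← Complex.reCLM.integral_comp_comm hi, ← integral_neg]
    refine integral_congr_ae (.of_forall fun ξ => ?_)
    simp only [cosIntegrandDeriv, ContinuousLinearMap.smulRight_apply, innerSL_apply_apply,
      Complex.reCLM_apply, Complex.smul_re, smul_eq_mul, mul_comm Complex.I,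
      Complex.exp_ofReal_mul_I_re, neg_mul, Real.cos_neg]
    ring
  have hint : IntegrableOn (fun ξ : Plane =>
      ‖ξ‖ ^ (-2 : ℤ) * (⟪ξ, x⟫ * Real.sin ⟪ξ, x⟫) * Real.cos (t * ‖ξ‖ ^ 2)) (freqSet a N) := by
    refine integrableOn_freqSet 1 (((measurable_norm_zpow.mul (by fun_prop)).mul
      (by fun_prop)).aestronglyMeasurable) fun ξ hξ => ?_
    rw [norm_mul, norm_mul, norm_mul, Real.norm_of_nonneg (by positivity : 0 ≤ ‖ξ‖ ^ (-2 : ℤ))]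
    refine mul_le_one₀ (mul_le_one₀ (norm_zpow_le_one hξ) (by positivity)
      (mul_le_one₀ ?_ (by positivity) (Real.abs_sin_le_one _))) (by positivity)
      (Real.abs_cos_le_one _)
    exact (abs_real_inner_le_norm ξ x).trans (hs ξ hξ)
  have hint' : IntegrableOn (fun ξ : Plane => 1 / 4 * (‖ξ‖ ^ (-2 : ℤ) * ⟪ξ, x⟫ ^ 2))
      (freqSet a N) := by
    refine (integrableOn_freqSet 1 ((measurable_norm_zpow.mul
      (by fun_prop)).aestronglyMeasurable) fun ξ hξ => ?_).const_mul _
    simp only [Pi.mul_apply]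
    rw [norm_mul, norm_pow, Real.norm_of_nonneg (by positivity : 0 ≤ ‖ξ‖ ^ (-2 : ℤ))]
    exact mul_le_one₀ (norm_zpow_le_one hξ) (by positivity)
      (pow_le_one₀ (by positivity) ((abs_real_inner_le_norm ξ x).trans (hs ξ hξ)))
  have hmono := setIntegral_mono_on hint' hint (measurableSet_freqSet a N) fun ξ hξ => by
    have h1 := half_sq_le_mul_sin ((abs_real_inner_le_norm ξ x).trans (hs ξ hξ))
    have h2 : 1 / 2 ≤ Real.cos (t * ‖ξ‖ ^ 2) := by
      have := Real.one_sub_sq_div_two_le_cos (x := t * ‖ξ‖ ^ 2)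
      have := (sq_le_one_iff_abs_le_one _).2 (ht ξ hξ)
      linarith
    calc 1 / 4 * (‖ξ‖ ^ (-2 : ℤ) * ⟪ξ, x⟫ ^ 2)
        = ‖ξ‖ ^ (-2 : ℤ) * (⟪ξ, x⟫ ^ 2 / 2) * (1 / 2) := by ring
      _ ≤ ‖ξ‖ ^ (-2 : ℤ) * (⟪ξ, x⟫ * Real.sin ⟪ξ, x⟫) * Real.cos (t * ‖ξ‖ ^ 2) := by
        gcongr
        exact mul_nonneg (by positivity) (le_trans (by positivity) h1)
  rw [integral_const_mul, setIntegral_freqSet_inner_sq, ← hTx] at hmono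
  have hle : -(T x).re ≤ ‖T‖ * ‖x‖ :=
    (neg_le_abs _).trans ((Complex.abs_re_le_norm _).trans (T.le_opNorm x))
  have hx' : 0 < ‖x‖ := norm_pos_iff.2 hx
  refine le_of_mul_le_mul_right ?_ hx'
  linarith

lemma le_re_wS {a b t : ℝ} {N : ℕ} {x : Plane} (hR : 1 ≤ Real.exp (-a) * N)
    (ht : ∀ ξ ∈ freqSet a N, |t * ‖ξ‖ ^ 2| ≤ b * ‖ξ‖)
    (hs : ‖x‖ ≤ b) (hb : b * (Real.exp (-a) * N) ≤ 1) :
    Real.sqrt (2 * π / Real.log N) * (2 * π) ^ (-2 : ℤ) *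
      (2 * π * Real.log (Real.exp (-a) * N) - b ^ 2 * volume.real (freqSet a N)) ≤
      (wS a N t x).re := by
  have hb0 : 0 ≤ b := (norm_nonneg x).trans hs
  rw [wS_eq_integral_cos, Complex.smul_re, smul_eq_mul]
  refine mul_le_mul_of_nonneg_left ?_ (by positivity)
  have hi := integrableOn_cosIntegrand a N t x
  rw [← Complex.reCLM_apply, ← Complex.reCLM.integral_comp_comm hi,
    ← setIntegral_freqSet_norm_zpow hR]
  have hz : IntegrableOn (fun ξ : Plane => ‖ξ‖ ^ (-2 : ℤ)) (freqSet a N) :=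
    integrableOn_freqSet 1 measurable_norm_zpow.aestronglyMeasurable fun ξ hξ => by
      rw [Real.norm_of_nonneg (by positivity)]
      exact norm_zpow_le_one hξ
  have hc : IntegrableOn (fun _ : Plane => b ^ 2) (freqSet a N) :=
    integrableOn_const (volume_freqSet_lt_top a N).ne
  have hconst : b ^ 2 * volume.real (freqSet a N) = ∫ _ξ in freqSet a N, b ^ 2 := by
    rw [setIntegral_const, smul_eq_mul, mul_comm]
  rw [hconst, ← integral_sub hz hc]
  refine setIntegral_mono_on (hz.sub hc) (Complex.reCLM.integrable_comp hi)
    (measurableSet_freqSet a N) fun ξ hξ => ?_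
  simp only [Complex.reCLM_apply, Complex.smul_re, smul_eq_mul, mul_comm Complex.I,
    Complex.exp_ofReal_mul_I_re, neg_mul, Real.cos_neg]
  have hbξ : b * ‖ξ‖ ≤ 1 := (mul_le_mul_of_nonneg_left hξ.2.le hb0).trans hb
  have hbξ0 : 0 ≤ b * ‖ξ‖ := by positivity
  have hcos : ∀ u : ℝ, |u| ≤ b * ‖ξ‖ → 1 - (b * ‖ξ‖) ^ 2 / 2 ≤ Real.cos u := by
    intro u hu
    have h1 := Real.one_sub_sq_div_two_le_cos (x := u)
    have h2 : u ^ 2 ≤ (b * ‖ξ‖) ^ 2 := sq_le_sq.2 (by rwa [abs_of_nonneg hbξ0])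
    linarith
  have hc1 := hcos (t * ‖ξ‖ ^ 2) (ht ξ hξ)
  have hc2 := hcos ⟪ξ, x⟫ ((abs_real_inner_le_norm ξ x).trans
    ((mul_comm _ _).trans_le (mul_le_mul_of_nonneg_right hs (norm_nonneg ξ))))
  have hprod : 1 - (b * ‖ξ‖) ^ 2 ≤ Real.cos ⟪ξ, x⟫ * Real.cos (t * ‖ξ‖ ^ 2) := by
    have h0 : (0 : ℝ) ≤ 1 - (b * ‖ξ‖) ^ 2 / 2 := by nlinarith
    have := mul_le_mul hc2 hc1 h0 (h0.trans hc2)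
    nlinarith [sq_nonneg ((b * ‖ξ‖) ^ 2)]
  calc ‖ξ‖ ^ (-2 : ℤ) - b ^ 2 = ‖ξ‖ ^ (-2 : ℤ) * (1 - (b * ‖ξ‖) ^ 2) := by
        linear_combination b ^ 2 * norm_zpow_mul_sq hξ
    _ ≤ ‖ξ‖ ^ (-2 : ℤ) * (Real.cos ⟪ξ, x⟫ * Real.cos (t * ‖ξ‖ ^ 2)) := by gcongr
    _ = _ := by ring

/-- pointwise bounds for `w_N` and its gradient on the concentration
region. -/
theorem statement19 :
    ∃ ε₀ : ℝ, 0 < ε₀ ∧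
      ∀ a ε : ℝ, 1/2 < a → 0 < ε → ε < ε₀ →
        ∃ c₁ c₂ : ℝ, 0 < c₁ ∧ 0 < c₂ ∧ ∃ N₀ : ℕ, ∀ N : ℕ, N₀ ≤ N →
          ∀ (t : ℝ) (x : Plane),
            ε ^ 2 / (4 * (N:ℝ) ^ 2) ≤ t → t ≤ ε ^ 2 / (2 * (N:ℝ) ^ 2) →
            ε / (4 * N) ≤ ‖x‖ → ‖x‖ ≤ ε / (2 * N) →
            c₁ * ε * N / Real.sqrt (Real.log N) ≤
                ‖fderiv ℝ (fun y => wS a N t y) x‖ ∧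
            ‖fderiv ℝ (fun y => wS a N t y) x‖ ≤
                c₂ * ε * N / Real.sqrt (Real.log N) ∧
            Real.sqrt (Real.log N / (2 * π)) - c₂ / Real.sqrt (Real.log N) ≤
                (wS a N t x).re := by
  refine ⟨1, one_pos, fun a ε ha hε hε1 => ?_⟩
  have hA : 0 < Real.sqrt (2 * π) * (2 * π) ^ (-2 : ℤ) := by positivity
  set A := Real.sqrt (2 * π) * (2 * π) ^ (-2 : ℤ) with hA_def
  refine ⟨A * π * Real.exp (-a) ^ 2 / 64, A * (2 * π * a + π), by positivity, by positivity,
    ⌈2 * Real.exp a⌉₊ + 2, fun N hN t x ht₁ ht₂ hx₁ hx₂ => ?_⟩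
  have hN2 : (2 : ℝ) ≤ N := by exact_mod_cast (Nat.le_add_left 2 _).trans hN
  have hN0 : (0 : ℝ) < N := by linarith
  have hR : 2 ≤ Real.exp (-a) * N := by
    have h1 : 2 * Real.exp a ≤ N :=
      (Nat.le_ceil _).trans (by exact_mod_cast (Nat.le_add_right _ 2).trans hN)
    calc (2 : ℝ) = Real.exp (-a) * (2 * Real.exp a) := by
          rw [mul_left_comm, ← Real.exp_add, neg_add_cancel, Real.exp_zero, mul_one]
      _ ≤ _ := by gcongr
  have hR1 : 1 ≤ Real.exp (-a) * N := by linarith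
  have hRN : Real.exp (-a) * N ≤ N :=
    mul_le_of_le_one_left hN0.le (Real.exp_le_one_iff.2 (by linarith))
  have hL : 0 < Real.log N := Real.log_pos (by linarith)
  have hlogR : Real.log (Real.exp (-a) * N) = Real.log N - a := by
    rw [Real.log_mul (Real.exp_pos _).ne' hN0.ne', Real.log_exp]; ring
  have hconst : Real.sqrt (2 * π / Real.log N) * (2 * π) ^ (-2 : ℤ) =
      A / Real.sqrt (Real.log N) := by
    rw [Real.sqrt_div (by positivity), hA_def]; ring
  have hvol := volume_real_freqSet hR1
  have hx_pos : 0 < ‖x‖ := lt_of_lt_of_le (by positivity) hx₁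
  have ht0 : 0 ≤ t := le_trans (by positivity) ht₁
  have hxb : ‖x‖ ≤ 1 / (2 * N) := hx₂.trans (by gcongr)
  have hξN : ∀ ξ ∈ freqSet a N, ‖ξ‖ ≤ N := fun ξ hξ => hξ.2.le.trans hRN
  have ht : ∀ ξ ∈ freqSet a N, |t * ‖ξ‖ ^ 2| ≤ 1 / (2 * N) * ‖ξ‖ := fun ξ hξ => by
    rw [abs_of_nonneg (by positivity)]
    calc t * ‖ξ‖ ^ 2 ≤ 1 ^ 2 / (2 * (N : ℝ) ^ 2) * (‖ξ‖ * N) := by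
          rw [sq ‖ξ‖]
          gcongr
          · exact ht₂.trans (by gcongr)
          · exact hξN ξ hξ
      _ = 1 / (2 * N) * ‖ξ‖ := by field_simp
  have hbN : ∀ r : ℝ, r ≤ N → 1 / (2 * N) * r ≤ 1 := fun r hr => by
    rw [div_mul_eq_mul_div, one_mul, div_le_one (by positivity)]
    linarith
  have hs : ∀ ξ ∈ freqSet a N, ‖ξ‖ * ‖x‖ ≤ 1 := fun ξ hξ => by
    rw [mul_comm]
    exact (mul_le_mul_of_nonneg_right hxb (norm_nonneg ξ)).trans (hbN _ (hξN ξ hξ))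
  have hgrad : ‖fderiv ℝ (fun y => wS a N t y) x‖ =
      A / Real.sqrt (Real.log N) * ‖∫ ξ in freqSet a N, cosIntegrandDeriv t x ξ‖ := by
    rw [fderiv_wS, hconst, norm_smul, Real.norm_of_nonneg (by positivity)]
  have hvol_lower : π * (Real.exp (-a) * N) ^ 2 / 2 ≤ volume.real (freqSet a N) := by
    rw [hvol, mul_div_assoc]
    gcongr
    nlinarith
  have hvol_upper : volume.real (freqSet a N) ≤ π * (N : ℝ) ^ 2 := by
    rw [hvol]
    gcongr
    nlinarith
  refine ⟨?_, ?_, ?_⟩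
  · rw [hgrad]
    calc A * π * Real.exp (-a) ^ 2 / 64 * ε * N / Real.sqrt (Real.log N)
        = A / Real.sqrt (Real.log N) *
          (ε / (4 * N) * (π * (Real.exp (-a) * N) ^ 2 / 2) / 8) := by field_simp; ring
      _ ≤ A / Real.sqrt (Real.log N) * (‖x‖ * volume.real (freqSet a N) / 8) := by gcongr
      _ ≤ _ := by
        gcongr
        exact le_norm_integral_cosIntegrandDeriv (norm_pos_iff.1 hx_pos)
          (fun ξ hξ => (ht ξ hξ).trans (hbN _ (hξN ξ hξ))) hs
  · rw [hgrad]
    calc A / Real.sqrt (Real.log N) * ‖∫ ξ in freqSet a N, cosIntegrandDeriv t x ξ‖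
        ≤ A / Real.sqrt (Real.log N) * (ε / (2 * N) * (π * (N : ℝ) ^ 2)) := by
          gcongr
          exact (norm_integral_cosIntegrandDeriv_le a N t x).trans (by gcongr)
      _ = A * (π / 2) * ε * N / Real.sqrt (Real.log N) := by field_simp
      _ ≤ _ := by
        gcongr
        nlinarith [Real.pi_pos]
  · refine le_trans ?_ (le_re_wS hR1 ht hxb (hbN _ hRN))
    rw [hconst, hlogR]
    have hmain : Real.sqrt (Real.log N / (2 * π)) =
        A / Real.sqrt (Real.log N) * (2 * π * Real.log N) := by
      have h2 : Real.sqrt (2 * π) ^ 2 = 2 * π := Real.sq_sqrt (by positivity)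
      have h3 : Real.sqrt (Real.log N) ^ 2 = Real.log N := Real.sq_sqrt hL.le
      rw [Real.sqrt_div hL.le, hA_def, zpow_neg]
      norm_cast
      rw [← h2, ← h3, Real.sqrt_sq (Real.sqrt_nonneg (Real.log N))]
      rw [Real.sqrt_sq (Real.sqrt_nonneg (2 * π))]
      field_simp
    have herr : (1 / (2 * (N : ℝ))) ^ 2 * volume.real (freqSet a N) ≤ π := by
      calc (1 / (2 * (N : ℝ))) ^ 2 * volume.real (freqSet a N)
          ≤ (1 / (2 * (N : ℝ))) ^ 2 * (π * (N : ℝ) ^ 2) := by gcongr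
        _ = π / 4 := by field_simp; norm_num
        _ ≤ π := by linarith [Real.pi_pos]
    rw [hmain]
    calc A / Real.sqrt (Real.log N) * (2 * π * Real.log N) -
          A * (2 * π * a + π) / Real.sqrt (Real.log N)
        = A / Real.sqrt (Real.log N) * (2 * π * (Real.log N - a) - π) := by ring
      _ ≤ _ := by gcongr
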